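/- Let $W$ be a closed linear subspace of $H$, let $V$ be any linear subspace of $H$, and let $t>0$ be such that $I(tw)>0$ for every $w\in W$ with $0<\|w\|_H\le 1$. Then there exists $\varepsilon>0$ such that for all $w\in W$ with $\|w\|_H\le 1$ and all $v\in V$ with $\|v\|_H\le 1$, if $tw+\varepsilon v\ne 0$ then $I(tw+\varepsilon v)>0$. -/

import Mathlib

open MeasureTheory Filter Topology

/-- The integral of `|f| ^ r` for `f` in `L^r` is the `r`-th power of its norm. -/
theorem integral_abs_rpow_eq_norm_rpow {Ω : Type*} [MeasurableSpace Ω] (μ : Measure Ω)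
    (r : ℝ) (hr : 0 < r) (f : Lp ℝ (ENNReal.ofReal r) μ) :
    ∫ x, |f x| ^ r ∂μ = ‖f‖ ^ r := by
  have h0 : ENNReal.ofReal r ≠ 0 := by simpa using hr
  have hint : 0 ≤ ∫ x, |f x| ^ r ∂μ :=
    integral_nonneg fun x => Real.rpow_nonneg (abs_nonneg _) _
  rw [Lp.norm_def, (Lp.memLp f).eLpNorm_eq_integral_rpow_norm h0 ENNReal.ofReal_ne_top,
    ENNReal.toReal_ofReal hr.le]
  simp only [Real.norm_eq_abs]
  rw [ENNReal.toReal_ofReal (Real.rpow_nonneg hint _), ← Real.rpow_mul hint,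
    inv_mul_cancel₀ hr.ne', Real.rpow_one]

/-- A norm-bounded family in a Hilbert space converges weakly along every ultrafilter. -/
theorem exists_weak_limit_of_norm_le {H : Type*} [NormedAddCommGroup H] [InnerProductSpace ℝ H]
    [CompleteSpace H] {ι : Type*} (U : Ultrafilter ι) (w : ι → H) (R : ℝ)
    (hw : ∀ i, ‖w i‖ ≤ R) :
    ∃ x : H, ‖x‖ ≤ R ∧ ∀ f : H →L[ℝ] ℝ, Tendsto (fun i => f (w i)) U (𝓝 (f x)) := by
  let e := InnerProductSpace.toDual ℝ H
  let φ : ι → WeakDual ℝ H := fun i => StrongDual.toWeakDual (e (w i))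
  have hK := WeakDual.isCompact_closedBall (𝕜 := ℝ) (E := H) 0 R
  obtain ⟨g, hg, hlim⟩ := hK.ultrafilter_le_nhds (U.map φ) (by
    simp only [le_principal_iff, Ultrafilter.mem_coe, Ultrafilter.mem_map]
    filter_upwards with i
    simpa [φ, e] using hw i)
  have hlim' : Tendsto φ U (𝓝 g) := hlim
  refine ⟨e.symm (WeakDual.toStrongDual g), ?_, fun f => ?_⟩
  · simpa using hg
  · have key := (WeakDual.eval_continuous (e.symm f)).continuousAt.tendsto.comp hlim'
    have heval : ∀ z : H, f z = inner ℝ z (e.symm f) := fun z => by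
      rw [real_inner_comm]
      exact (InnerProductSpace.toDual_symm_apply (𝕜 := ℝ)).symm
    simp only [heval]
    have hx : inner ℝ (e.symm (WeakDual.toStrongDual g)) (e.symm f) = g (e.symm f) :=
      InnerProductSpace.toDual_symm_apply (𝕜 := ℝ)
    rw [hx]
    exact key

/-- A compact operator maps bounded weakly convergent families, along an ultrafilter, to strongly
convergent ones. -/
theorem IsCompactOperator.tendsto_of_weak_limit {E F : Type*} [NormedAddCommGroup E]
    [NormedSpace ℝ E] [NormedAddCommGroup F] [NormedSpace ℝ F] {T : E →L[ℝ] F}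
    (hT : IsCompactOperator T) {ι : Type*} (U : Ultrafilter ι) (w : ι → E) (R : ℝ)
    (hw : ∀ i, ‖w i‖ ≤ R) (x : E)
    (hx : ∀ f : E →L[ℝ] ℝ, Tendsto (fun i => f (w i)) U (𝓝 (f x))) :
    Tendsto (fun i => T (w i)) U (𝓝 (T x)) := by
  obtain ⟨K, hK, hsub⟩ :=
    IsCompactOperator.image_closedBall_subset_compact (f := T.toLinearMap) hT R
  obtain ⟨y, -, hlim⟩ := hK.ultrafilter_le_nhds (U.map fun i => T (w i)) (by
    simp only [le_principal_iff, Ultrafilter.mem_coe, Ultrafilter.mem_map]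
    filter_upwards with i
    exact hsub ⟨w i, by simpa using hw i, rfl⟩)
  have hlim' : Tendsto (fun i => T (w i)) U (𝓝 y) := hlim
  have hy : T x = y := (SeparatingDual.eq_iff_forall_dual_eq (R := ℝ)).2 fun g =>
    tendsto_nhds_unique (hx (g.comp T)) (g.continuous.continuousAt.tendsto.comp hlim')
  rwa [hy]

/-- A closed subspace of a Hilbert space contains the weak limits of its families. -/
theorem Submodule.mem_of_weak_limit {H : Type*} [NormedAddCommGroup H] [InnerProductSpace ℝ H]
    [CompleteSpace H] (W : Submodule ℝ H) (hW : IsClosed (W : Set H)) {ι : Type*}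
    {l : Filter ι} [l.NeBot] {w : ι → H} (hw : ∀ i, w i ∈ W) {x : H}
    (hx : ∀ f : H →L[ℝ] ℝ, Tendsto (fun i => f (w i)) l (𝓝 (f x))) : x ∈ W := by
  have : CompleteSpace W := hW.completeSpace_coe
  rw [← W.orthogonal_orthogonal, Submodule.mem_orthogonal]
  intro v hv
  have h := hx (innerSL ℝ v)
  simp only [innerSL_apply_apply, W.inner_left_of_mem_orthogonal (hw _) hv] at h
  exact tendsto_nhds_unique h tendsto_const_nhds

/-- Perturbation claim (B) of Lemma 3.1: if `W` is a closed subspace, `V` a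
subspace, and `t > 0` is such that `I(tw) > 0` for all `w ∈ W` with `0 < ‖w‖ ≤ 1`, then there
is `ε > 0` such that `I(tw + εv) > 0` whenever `w ∈ W`, `‖w‖ ≤ 1`, `v ∈ V`, `‖v‖ ≤ 1` and
`tw + εv ≠ 0`. -/
theorem perturbation_keeps_positivity
    {H : Type*} [NormedAddCommGroup H] [InnerProductSpace ℝ H] [CompleteSpace H]
    {Ω : Type*} [MeasurableSpace Ω] (μ : Measure Ω)
    (q : ℝ) (hq : 1 < q) [Fact (1 ≤ ENNReal.ofReal (q + 1))]
    (T : H →L[ℝ] Lp ℝ (ENNReal.ofReal (q + 1)) μ)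
    (hTcomp : IsCompactOperator T) (hTinj : Function.Injective T)
    (B : H →L[ℝ] H →L[ℝ] ℝ) (hBsymm : ∀ u v : H, B u v = B v u)
    (c0 : ℝ) (hc0 : 0 < c0) (hBcoer : ∀ u : H, c0 * ‖u‖ ^ 2 ≤ B u u)
    (I : H → ℝ)
    (hI : ∀ u : H, I u = (1 / 2) * B u u - (1 / (q + 1)) * ∫ x, |(T u) x| ^ (q + 1) ∂μ)
    (W : Submodule ℝ H) (hW : IsClosed (W : Set H))
    (V : Submodule ℝ H)
    (t : ℝ) (ht : 0 < t)
    (htI : ∀ w ∈ W, 0 < ‖w‖ → ‖w‖ ≤ 1 → 0 < I (t • w)) :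
    ∃ ε > (0 : ℝ), ∀ w ∈ W, ‖w‖ ≤ 1 → ∀ v ∈ V, ‖v‖ ≤ 1 →
      t • w + ε • v ≠ 0 → 0 < I (t • w + ε • v) := by
  have hp : 0 < q + 1 := by linarith
  simp only [integral_abs_rpow_eq_norm_rpow μ (q + 1) hp] at hI
  by_contra! hcon
  choose w hwW hw1 v _ hv1 hne hIle using
    fun n : ℕ => hcon (1 / ((n : ℝ) + 1)) Nat.one_div_pos_of_nat
  set u : ℕ → H := fun n => t • w n + (1 / ((n : ℝ) + 1)) • v n with hu
  let U : Ultrafilter ℕ := hyperfilter ℕ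
  obtain ⟨x, hx1, hx⟩ := exists_weak_limit_of_norm_le U w 1 hw1
  have hxW : x ∈ W := W.mem_of_weak_limit hW hwW hx
  have hsmall : Tendsto (fun n : ℕ => (1 / ((n : ℝ) + 1)) • v n) U (𝓝 0) := by
    refine Tendsto.mono_left ?_ Nat.hyperfilter_le_atTop
    refine squeeze_zero_norm (fun n => ?_) (tendsto_one_div_add_atTop_nhds_zero_nat (𝕜 := ℝ))
    have h0 : (0 : ℝ) ≤ 1 / ((n : ℝ) + 1) := by positivity
    rw [norm_smul, Real.norm_of_nonneg h0]
    exact mul_le_of_le_one_right h0 (hv1 n)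
  have huweak : ∀ f : H →L[ℝ] ℝ, Tendsto (fun n => f (u n)) U (𝓝 (f (t • x))) := by
    intro f
    simpa [hu] using ((hx f).const_mul t).add ((f.continuous.tendsto 0).comp hsmall)
  have hTu : Tendsto (fun n => T (u n)) U (𝓝 (T (t • x))) := by
    have h := ((hTcomp.tendsto_of_weak_limit U w 1 hw1 x hx).const_smul t).add
      ((T.continuous.tendsto 0).comp hsmall)
    simpa [hu, Function.comp_def] using h
  have hB : ∀ n, B (u n) (u n) ≤ 2 / (q + 1) * ‖T (u n)‖ ^ (q + 1) := by
    intro n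
    have h := hIle n
    rw [hI] at h
    have : 2 / (q + 1) * ‖T (u n)‖ ^ (q + 1) = 2 * (1 / (q + 1) * ‖T (u n)‖ ^ (q + 1)) := by
      ring
    linarith
  by_cases hx0 : x = 0
  · have hbound : ∀ n, c0 ≤ 2 / (q + 1) * (‖T (u n)‖ ^ (q - 1) * ‖T‖ ^ 2) := by
      intro n
      have hupos : 0 < ‖u n‖ := norm_pos_iff.2 (hne n)
      have hsplit : ‖T (u n)‖ ^ (q + 1) = ‖T (u n)‖ ^ (q - 1) * ‖T (u n)‖ ^ 2 := by
        rw [← Real.rpow_natCast, ← Real.rpow_add_of_nonneg (norm_nonneg _) (by linarith)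
          (by norm_num)]
        congr 1
        push_cast
        ring
      refine le_of_mul_le_mul_right ?_ (pow_pos hupos 2)
      calc c0 * ‖u n‖ ^ 2 ≤ 2 / (q + 1) * (‖T (u n)‖ ^ (q - 1) * ‖T (u n)‖ ^ 2) :=
            hsplit ▸ (hBcoer (u n)).trans (hB n)
        _ ≤ 2 / (q + 1) * (‖T (u n)‖ ^ (q - 1) * (‖T‖ * ‖u n‖) ^ 2) := by
            gcongr
            exact T.le_opNorm _
        _ = _ := by ring
    have hlim : Tendsto (fun n => 2 / (q + 1) * (‖T (u n)‖ ^ (q - 1) * ‖T‖ ^ 2)) U (𝓝 0) := by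
      have h := (hTu.norm.rpow_const (p := q - 1) (Or.inr (by linarith))).mul_const (‖T‖ ^ 2)
      simpa [hx0, Real.zero_rpow (by linarith : q - 1 ≠ 0)] using h.const_mul (2 / (q + 1))
    exact hc0.not_ge (ge_of_tendsto' hlim hbound)
  · have hlower : ∀ n, 2 * B (t • x) (u n) - B (t • x) (t • x) ≤
        2 / (q + 1) * ‖T (u n)‖ ^ (q + 1) := by
      intro n
      have h := (mul_nonneg hc0.le (sq_nonneg _)).trans (hBcoer (u n - t • x))
      rw [map_sub, map_sub, sub_apply, sub_apply,
        hBsymm (u n) (t • x)] at h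
      linarith [hB n]
    have hle := le_of_tendsto_of_tendsto' (((huweak (B (t • x))).const_mul 2).sub_const _)
      ((hTu.norm.rpow_const (p := q + 1) (Or.inr hp.le)).const_mul (2 / (q + 1))) hlower
    have hpos := htI x hxW (norm_pos_iff.2 hx0) hx1
    rw [hI] at hpos
    have : 2 / (q + 1) * ‖T (t • x)‖ ^ (q + 1) = 2 * (1 / (q + 1) * ‖T (t • x)‖ ^ (q + 1)) := by
      ring
    linarith
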